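/- Metric mean dimension of a sponge system: for the sponge system (X_Ω, σ, d) associated to a subshift Ω ⊆ (∏_{l=1}^r {0,...,m_l−1})^ℕ with 2 ≤ m_1 ≤ ... ≤ m_r, the metric mean dimension exists and equals h_top(Ω, σ)/log m_r + Σ_{i=1}^{r−1} (1/log m_i − 1/log m_{i+1}) · h_top(π_i(Ω), σ). -/

import Mathlib

open scoped Classical
open Filter

noncomputable def diamBy {X : Type*} (d : X → X → ℝ) (U : Set X) : ℝ :=
  sSup {c : ℝ | ∃ x ∈ U, ∃ y ∈ U, d x y = c}

noncomputable def covNumBy {X : Type*} (d : X → X → ℝ) (ε : ℝ) : ℕ :=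
  sInf {n | ∃ F : Fin n → Set X,
    (∀ i, diamBy d (F i) < ε) ∧ (⋃ i, F i) = Set.univ}

noncomputable def bowen {X : Type*} (d : X → X → ℝ) (T : X → X) (N : ℕ) :
    X → X → ℝ :=
  fun x y => ⨆ n : Fin N, d (T^[(n : ℕ)] x) (T^[(n : ℕ)] y)

/-- Topological entropy of `(X, T)` with respect to the distance `d`. -/
noncomputable def topEnt {X : Type*} (d : X → X → ℝ) (T : X → X) : ℝ :=
  limsup (fun ε : ℝ =>
      limsup (fun N : ℕ => Real.log (covNumBy (bowen d T N) ε) / N) atTop)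
    (nhdsWithin 0 (Set.Ioi 0))

noncomputable def spongeSet (m : ℕ → ℕ) (Ω : Set (ℕ → ℕ → ℕ)) :
    Set (ℕ → ℕ → ℝ) :=
  {z | ∃ ω : ℕ → (ℕ → ℕ → ℕ), (∀ k, ω k ∈ Ω) ∧
    ∀ j l, z j l = ∑' k : ℕ, (ω k j l : ℝ) / (m l : ℝ) ^ (k + 1)}

noncomputable def spongeDist (r : ℕ) (z w : ℕ → ℕ → ℝ) : ℝ :=
  ∑' j : ℕ, ((2 : ℝ)⁻¹) ^ (j + 1) * (⨆ l ∈ Finset.Icc 1 r, |z j l - w j l|)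

def spongeShift (z : ℕ → ℕ → ℝ) : ℕ → ℕ → ℝ := fun j l => z (j + 1) l

/-- Truncation onto the first `i` coordinate factors (the factor map `π_i`). -/
def truncL (i : ℕ) (x : ℕ → ℕ → ℕ) : ℕ → ℕ → ℕ :=
  fun k l => if l ≤ i then x k l else 0

/-- The symbolic metric `d(x,y) = 2^{−min{k : x_k ≠ y_k}}` (comparing only the
coordinates `1 ≤ l ≤ r`). -/
noncomputable def symDist (r : ℕ) (x y : ℕ → ℕ → ℕ) : ℝ :=
  if ∀ k l, 1 ≤ l → l ≤ r → x k l = y k l then 0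
  else (2 : ℝ)⁻¹ ^ sInf {k : ℕ | ∃ l, 1 ≤ l ∧ l ≤ r ∧ x k l ≠ y k l}

/-- Topological entropy of a subshift `S ⊆ (∏_l I_l)^ℕ` with the shift map. -/
noncomputable def subshiftEnt (r : ℕ) (S : Set (ℕ → ℕ → ℕ)) : ℝ :=
  topEnt (fun x y : ↥S => symDist r (x : ℕ → ℕ → ℕ) (y : ℕ → ℕ → ℕ))
    (fun x => if h : (fun k l => (x : ℕ → ℕ → ℕ) (k + 1) l) ∈ S then ⟨_, h⟩ else x)

section Helpers

noncomputable def spVal (b : ℕ) (d : ℕ → ℕ) : ℝ := ∑' k : ℕ, (d k : ℝ) / (b : ℝ) ^ (k + 1)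

def spPre (b : ℕ) (d : ℕ → ℕ) : ℕ → ℕ
  | 0 => 0
  | L + 1 => b * spPre b d L + d L

lemma spGeom (b : ℕ) (hb : 2 ≤ b) :
    HasSum (fun k : ℕ => ((b : ℝ) - 1) / (b : ℝ) ^ (k + 1)) 1 := by
  have hb' : (2 : ℝ) ≤ b := by exact_mod_cast hb
  have h1 : (b : ℝ)⁻¹ < 1 := inv_lt_one_of_one_lt₀ (by linarith)
  have h := (hasSum_geometric_of_lt_one (by positivity) h1).mul_left (((b : ℝ) - 1) * (b : ℝ)⁻¹)
  have e : ((b : ℝ) - 1) * (b : ℝ)⁻¹ * (1 - (b : ℝ)⁻¹)⁻¹ = 1 := by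
    have : (b : ℝ) - 1 ≠ 0 := by linarith
    have h0 : (b : ℝ) ≠ 0 := by linarith
    have : (1 - (b : ℝ)⁻¹) ≠ 0 := by linarith
    field_simp
  rw [e] at h
  have e2 : (fun k : ℕ => ((b : ℝ) - 1) / (b : ℝ) ^ (k + 1)) =
      fun k : ℕ => ((b : ℝ) - 1) * (b : ℝ)⁻¹ * (b : ℝ)⁻¹ ^ k := by
    ext k
    have h0 : (b : ℝ) ≠ 0 := by linarith
    rw [inv_pow, pow_succ]
    field_simp
  rw [e2]
  exact h

lemma spVal_summable (b : ℕ) (hb : 2 ≤ b) (d : ℕ → ℕ) (hd : ∀ k, d k < b) :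
    Summable (fun k : ℕ => (d k : ℝ) / (b : ℝ) ^ (k + 1)) := by
  refine Summable.of_nonneg_of_le (fun k => by positivity) (fun k => ?_) (spGeom b hb).summable
  have : (d k : ℝ) + 1 ≤ b := by exact_mod_cast hd k
  gcongr
  linarith

lemma spVal_bounds (b : ℕ) (hb : 2 ≤ b) (d : ℕ → ℕ) (hd : ∀ k, d k < b) :
    0 ≤ spVal b d ∧ spVal b d ≤ 1 := by
  refine ⟨tsum_nonneg (fun k => by positivity), ?_⟩
  rw [← (spGeom b hb).tsum_eq]
  refine Summable.tsum_le_tsum (fun k => ?_) (spVal_summable b hb d hd) (spGeom b hb).summable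
  have : (d k : ℝ) + 1 ≤ b := by exact_mod_cast hd k
  gcongr
  linarith

lemma spPre_sum (b : ℕ) (hb : 2 ≤ b) (d : ℕ → ℕ) (L : ℕ) :
    ∑ k ∈ Finset.range L, (d k : ℝ) / (b : ℝ) ^ (k + 1) = (spPre b d L : ℝ) / (b : ℝ) ^ L := by
  have h0 : (b : ℝ) ≠ 0 := by positivity
  induction L with
  | zero => simp [spPre]
  | succ L ih =>
    rw [Finset.sum_range_succ, ih, spPre]
    push_cast
    rw [pow_succ]
    field_simp

lemma spVal_pre (b : ℕ) (hb : 2 ≤ b) (d : ℕ → ℕ) (hd : ∀ k, d k < b) (L : ℕ) :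
    (spPre b d L : ℝ) / (b : ℝ) ^ L ≤ spVal b d ∧
    spVal b d ≤ ((spPre b d L : ℝ) + 1) / (b : ℝ) ^ L := by
  have h0 : (b : ℝ) ≠ 0 := by positivity
  have h := (spVal_summable b hb d hd).sum_add_tsum_nat_add L
  rw [spPre_sum b hb] at h
  have e : ∑' k : ℕ, (d (k + L) : ℝ) / (b : ℝ) ^ (k + L + 1)
      = spVal b (fun k => d (k + L)) / (b : ℝ) ^ L := by
    rw [spVal, ← tsum_div_const]
    congr 1
    ext k
    rw [div_div, ← pow_add]
    congr 2
    omega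
  rw [e] at h
  have hv := spVal_bounds b hb (fun k => d (k + L)) (fun k => hd _)
  have hp : (0 : ℝ) < (b : ℝ) ^ L := by positivity
  rw [spVal, ← h, add_div]
  constructor
  · have : 0 ≤ spVal b (fun k => d (k + L)) / (b : ℝ) ^ L := div_nonneg hv.1 hp.le
    linarith
  · gcongr
    exact hv.2

lemma spPre_inj (b : ℕ) (d e : ℕ → ℕ) (hd : ∀ k, d k < b) (he : ∀ k, e k < b) (L : ℕ)
    (h : spPre b d L = spPre b e L) : ∀ k < L, d k = e k := by
  induction L with
  | zero => intro k hk; omega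
  | succ L ih =>
    simp only [spPre] at h
    have hb : 0 < b := lt_of_le_of_lt (Nat.zero_le _) (hd 0)
    have h1 : d L = e L := by
      have := congrArg (· % b) h
      simpa [Nat.mul_add_mod, Nat.mod_eq_of_lt (hd L), Nat.mod_eq_of_lt (he L)] using this
    have h2 : spPre b d L = spPre b e L := by
      rw [h1] at h
      exact Nat.eq_of_mul_eq_mul_left hb (by omega)
    intro k hk
    rcases Nat.lt_succ_iff_lt_or_eq.mp hk with h3 | h3
    · exact ih h2 k h3
    · rw [h3, h1]

lemma spPre_congr (b : ℕ) (d e : ℕ → ℕ) (L : ℕ) (h : ∀ k < L, d k = e k) :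
    spPre b d L = spPre b e L := by
  induction L with
  | zero => rfl
  | succ L ih =>
    simp only [spPre]
    rw [ih (fun k hk => h k (by omega)), h L (by omega)]

/-! ### covering numbers -/

lemma spCov_le {X : Type*} (d : X → X → ℝ) (ε : ℝ) {ι : Type*} (C : Finset ι) (F : ι → Set X)
    (hF : ∀ i ∈ C, diamBy d (F i) < ε) (hc : ∀ x, ∃ i ∈ C, x ∈ F i) :
    (∃ F : Fin C.card → Set X, (∀ i, diamBy d (F i) < ε) ∧ (⋃ i, F i) = Set.univ) ∧
    covNumBy d ε ≤ C.card := by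
  have : ∃ F : Fin C.card → Set X, (∀ i, diamBy d (F i) < ε) ∧ (⋃ i, F i) = Set.univ := by
    refine ⟨fun i => F (C.equivFin.symm i), fun i => hF _ (C.equivFin.symm i).2, ?_⟩
    ext x
    simp only [Set.mem_iUnion, Set.mem_univ, iff_true]
    obtain ⟨i, hi, hx⟩ := hc x
    exact ⟨C.equivFin ⟨i, hi⟩, by simpa using hx⟩
  exact ⟨this, Nat.sInf_le this⟩

lemma spCov_ge {X : Type*} (d : X → X → ℝ) (ε : ℝ)
    (hne : ∃ n, ∃ F : Fin n → Set X, (∀ i, diamBy d (F i) < ε) ∧ (⋃ i, F i) = Set.univ)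
    {ι : Type*} (C : Finset ι) (f : ι → X) (B : ℕ)
    (hB : ∀ U : Set X, diamBy d U < ε → (C.filter (fun c => f c ∈ U)).card ≤ B) :
    C.card ≤ B * covNumBy d ε := by
  have hmem := Nat.sInf_mem (s := {n | ∃ F : Fin n → Set X, (∀ i, diamBy d (F i) < ε) ∧ (⋃ i, F i) = Set.univ}) hne
  obtain ⟨F, hF, hu⟩ := hmem
  have hx : ∀ c, ∃ i, f c ∈ F i := fun c => by
    have : f c ∈ ⋃ i, F i := by rw [hu]; trivial
    simpa using this
  choose g hg using hx
  refine (Finset.card_le_mul_card_image (f := g) C B ?_).trans ?_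
  · intro a _
    refine le_trans (Finset.card_le_card ?_) (hB (F a) (hF a))
    intro c hc
    simp only [Finset.mem_filter] at hc ⊢
    exact ⟨hc.1, hc.2 ▸ hg c⟩
  · refine Nat.mul_le_mul_left _ ?_
    refine (Finset.card_le_univ _).trans ?_
    simp [covNumBy]

lemma spDiam_lt {X : Type*} (d : X → X → ℝ) (ε δ : ℝ) (hδ : 0 ≤ δ) (hδε : δ < ε) (U : Set X)
    (h : ∀ x ∈ U, ∀ y ∈ U, d x y ≤ δ) : diamBy d U < ε := by
  refine lt_of_le_of_lt ?_ hδε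
  refine Real.sSup_le ?_ hδ
  rintro c ⟨x, hx, y, hy, rfl⟩
  exact h x hx y hy

lemma spDiam_ge {X : Type*} (d : X → X → ℝ) (ε M : ℝ) (hM : ∀ x y, d x y ≤ M) (U : Set X)
    (h : diamBy d U < ε) (x y : X) (hx : x ∈ U) (hy : y ∈ U) : d x y < ε := by
  refine lt_of_le_of_lt (le_csSup (a := d x y) ?_ ?_) h
  swap
  · exact ⟨x, hx, y, hy, rfl⟩
  refine ⟨M, ?_⟩
  rintro c ⟨x, _, y, _, rfl⟩
  exact hM x y

/-! ### words -/

def SpDig (r : ℕ) (m : ℕ → ℕ) (Ω : Set (ℕ → ℕ → ℕ)) : Prop :=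
  ∀ x ∈ Ω, ∀ k l, (1 ≤ l → l ≤ r → x k l < m l) ∧ (l = 0 ∨ r < l → x k l = 0)

def SpSh (Ω : Set (ℕ → ℕ → ℕ)) : Prop := ∀ x ∈ Ω, (fun k l => x (k + 1) l) ∈ Ω

def spRestr (i N : ℕ) (x : ℕ → ℕ → ℕ) : ℕ → ℕ → ℕ :=
  fun k l => if k < N ∧ l ≤ i then x k l else 0

lemma spRestr_eq (i N : ℕ) (x y : ℕ → ℕ → ℕ) :
    spRestr i N x = spRestr i N y ↔ ∀ k < N, ∀ l ≤ i, x k l = y k l := by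
  constructor
  · intro h k hk l hl
    have := congrFun (congrFun h k) l
    simpa [spRestr, hk, hl] using this
  · intro h
    ext k l
    simp only [spRestr]
    split_ifs with hh
    · exact h k hh.1 l hh.2
    · rfl

lemma spWords_finite {r : ℕ} {m : ℕ → ℕ} {Ω : Set (ℕ → ℕ → ℕ)} (hΩ : SpDig r m Ω) (i N : ℕ) :
    (spRestr i N '' Ω).Finite := by
  set M := (∑ l ∈ Finset.range (r + 1), m l) + 1 with hM
  let g : (Fin N → Fin (r + 1) → Fin M) → ℕ → ℕ → ℕ := fun c k l =>
    if h : k < N ∧ l < r + 1 then (c ⟨k, h.1⟩ ⟨l, h.2⟩ : ℕ) else 0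
  refine (Set.finite_range g).subset ?_
  rintro _ ⟨x, hx, rfl⟩
  have hb : ∀ k l, spRestr i N x k l < M := by
    intro k l
    simp only [spRestr]
    split_ifs with h
    · by_cases hl : 1 ≤ l ∧ l ≤ r
      · have := (hΩ x hx k l).1 hl.1 hl.2
        have h2 : m l ≤ ∑ l ∈ Finset.range (r + 1), m l :=
          Finset.single_le_sum (f := m) (fun _ _ => Nat.zero_le _)
            (Finset.mem_range.2 (by omega))
        omega
      · rw [(hΩ x hx k l).2 (by omega)]; omega
    · omega
  refine ⟨fun k l => ⟨spRestr i N x k l, hb k l⟩, ?_⟩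
  ext k l
  simp only [g]
  split_ifs with h
  · rfl
  · simp only [spRestr]
    split_ifs with h2
    · exact ((hΩ x hx k l).2 (by omega)).symm
    · rfl

noncomputable def spWd (Ω : Set (ℕ → ℕ → ℕ)) (i N : ℕ) : Finset (ℕ → ℕ → ℕ) :=
  if h : (spRestr i N '' Ω).Finite then h.toFinset else ∅

lemma mem_spWd {r : ℕ} {m : ℕ → ℕ} {Ω : Set (ℕ → ℕ → ℕ)} (hΩ : SpDig r m Ω) (i N : ℕ)
    (c : ℕ → ℕ → ℕ) : c ∈ spWd Ω i N ↔ ∃ x ∈ Ω, spRestr i N x = c := by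
  rw [spWd, dif_pos (spWords_finite hΩ i N)]
  simp

lemma spWd_pos {r : ℕ} {m : ℕ → ℕ} {Ω : Set (ℕ → ℕ → ℕ)} (hΩ : SpDig r m Ω) (hne : Ω.Nonempty)
    (i N : ℕ) : 0 < (spWd Ω i N).card := by
  obtain ⟨x, hx⟩ := hne
  exact Finset.card_pos.2 ⟨_, (mem_spWd hΩ i N _).2 ⟨x, hx, rfl⟩⟩

lemma spWd_zero {r : ℕ} {m : ℕ → ℕ} {Ω : Set (ℕ → ℕ → ℕ)} (hΩ : SpDig r m Ω) (hne : Ω.Nonempty)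
    (N : ℕ) : (spWd Ω 0 N).card = 1 := by
  obtain ⟨x, hx⟩ := hne
  rw [Finset.card_eq_one]
  refine ⟨spRestr 0 N x, ?_⟩
  ext c
  rw [mem_spWd hΩ, Finset.mem_singleton]
  constructor
  · rintro ⟨y, hy, rfl⟩
    rw [spRestr_eq]
    intro k _ l hl
    rw [(hΩ x hx k l).2 (by omega), (hΩ y hy k l).2 (by omega)]
  · rintro rfl
    exact ⟨x, hx, rfl⟩

lemma spShift_mem {Ω : Set (ℕ → ℕ → ℕ)} (hs : SpSh Ω) (n : ℕ) : ∀ x ∈ Ω,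
    (fun k l => x (k + n) l) ∈ Ω := by
  induction n with
  | zero => intro x hx; exact hx
  | succ n ih =>
    intro x hx
    have := ih _ (hs x hx)
    simpa only [add_assoc] using this

lemma spWd_submul {r : ℕ} {m : ℕ → ℕ} {Ω : Set (ℕ → ℕ → ℕ)} (hΩ : SpDig r m Ω) (hs : SpSh Ω)
    (i a b : ℕ) : (spWd Ω i (a + b)).card ≤ (spWd Ω i a).card * (spWd Ω i b).card := by
  rw [← Finset.card_product]
  refine Finset.card_le_card_of_injOn
    (fun c => (spRestr i a c, spRestr i b (fun k l => c (k + a) l))) ?_ ?_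
  · intro c hc
    obtain ⟨x, hx, rfl⟩ := (mem_spWd hΩ i _ c).1 hc
    simp only [Finset.coe_product, Set.mem_prod, Finset.mem_coe, mem_spWd hΩ]
    refine ⟨⟨x, hx, ?_⟩, ⟨_, spShift_mem hs a x hx, ?_⟩⟩
    · rw [spRestr_eq]
      intro k hk l hl
      rw [spRestr, if_pos (by omega)]
    · rw [spRestr_eq]
      intro k hk l hl
      rw [spRestr, if_pos (by omega)]
  · intro c hc c' hc' h
    obtain ⟨x, hx, rfl⟩ := (mem_spWd hΩ i _ c).1 hc
    obtain ⟨y, hy, rfl⟩ := (mem_spWd hΩ i _ c').1 hc'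
    simp only [Prod.mk.injEq, spRestr_eq] at h
    rw [spRestr_eq]
    intro k hk l hl
    by_cases hka : k < a
    · have := h.1 k hka l hl
      simpa only [spRestr, if_pos (show k < a + b ∧ l ≤ i by omega)] using this
    · have := h.2 (k - a) (by omega) l hl
      simpa only [spRestr, Nat.sub_add_cancel (not_lt.1 hka),
        if_pos (show k < a + b ∧ l ≤ i by omega)] using this

lemma spH_exists {r : ℕ} {m : ℕ → ℕ} {Ω : Set (ℕ → ℕ → ℕ)} (hΩ : SpDig r m Ω) (hs : SpSh Ω)
    (hne : Ω.Nonempty) (i : ℕ) :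
    ∃ h : ℝ, Tendsto (fun N : ℕ => Real.log (spWd Ω i N).card / N) atTop (nhds h) := by
  have hsub : Subadditive (fun N : ℕ => Real.log (spWd Ω i N).card) := by
    intro a b
    have ha : ((spWd Ω i a).card : ℝ) ≠ 0 := by exact_mod_cast (spWd_pos hΩ hne i a).ne'
    have hb : ((spWd Ω i b).card : ℝ) ≠ 0 := by exact_mod_cast (spWd_pos hΩ hne i b).ne'
    rw [← Real.log_mul ha hb]
    apply Real.log_le_log
    · exact_mod_cast spWd_pos hΩ hne i _
    · exact_mod_cast spWd_submul hΩ hs i a b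
  refine ⟨hsub.lim, hsub.tendsto_lim ⟨0, ?_⟩⟩
  rintro _ ⟨n, rfl⟩
  exact div_nonneg (Real.log_natCast_nonneg _) (Nat.cast_nonneg _)

lemma spTend_shift (f : ℕ → ℝ) (h : ℝ) (p : ℕ)
    (hf : Tendsto (fun N : ℕ => f N / N) atTop (nhds h)) :
    Tendsto (fun N : ℕ => f (N + p) / N) atTop (nhds h) := by
  have h1 := hf.comp (tendsto_add_atTop_nat p)
  have h2 : Tendsto (fun N : ℕ => 1 + (p : ℝ) / (N : ℝ)) atTop (nhds (1 + 0)) :=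
    tendsto_const_nhds.add (tendsto_const_div_atTop_nhds_zero_nat _)
  have h3 := h1.mul h2
  rw [add_zero, mul_one] at h3
  refine h3.congr' ?_
  filter_upwards [eventually_gt_atTop 0] with N hN
  have : (N : ℝ) ≠ 0 := by positivity
  have : (N : ℝ) + p ≠ 0 := by positivity
  simp only [Function.comp]
  push_cast
  field_simp

/-! ### symbolic entropy -/

lemma symDist_le (r p : ℕ) (x y : ℕ → ℕ → ℕ)
    (h : ∀ k < p, ∀ l, 1 ≤ l → l ≤ r → x k l = y k l) : symDist r x y ≤ (2 : ℝ)⁻¹ ^ p := by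
  unfold symDist
  split_ifs with h1
  · positivity
  · apply pow_le_pow_of_le_one (by norm_num) (by norm_num)
    push Not at h1
    obtain ⟨k, l, h1, h2, h3⟩ := h1
    refine le_csInf ⟨k, l, h1, h2, h3⟩ ?_
    rintro k' ⟨l', h1', h2', h3'⟩
    by_contra hlt
    exact h3' (h k' (not_le.1 hlt) l' h1' h2')

lemma symDist_lt_one (r : ℕ) (x y : ℕ → ℕ → ℕ) (h : symDist r x y < 1) :
    ∀ l, 1 ≤ l → l ≤ r → x 0 l = y 0 l := by
  intro l h1 h2
  by_contra hne
  unfold symDist at h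
  rw [if_neg (fun hh => hne (hh 0 l h1 h2))] at h
  have : sInf {k : ℕ | ∃ l, 1 ≤ l ∧ l ≤ r ∧ x k l ≠ y k l} = 0 :=
    Nat.sInf_eq_zero.2 (Or.inl ⟨l, h1, h2, hne⟩)
  rw [this] at h
  simp at h

lemma spSym_iter (S : Set (ℕ → ℕ → ℕ)) (hs : SpSh S) (n : ℕ) (x : ↥S) :
    (((fun x : ↥S => if h : (fun k l => (x : ℕ → ℕ → ℕ) (k + 1) l) ∈ S
      then (⟨_, h⟩ : ↥S) else x)^[n] x : ↥S) : ℕ → ℕ → ℕ) = fun k l => (x : ℕ → ℕ → ℕ) (k + n) l := by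
  induction n generalizing x with
  | zero => rfl
  | succ n ih =>
    rw [Function.iterate_succ_apply, ih, dif_pos (hs _ x.2)]
    ext k l
    simp only
    congr 1
    

lemma spBowen_le {X : Type*} (d : X → X → ℝ) (T : X → X) (N : ℕ) (x y : X) (δ : ℝ) (hδ : 0 ≤ δ)
    (h : ∀ n < N, d (T^[n] x) (T^[n] y) ≤ δ) : bowen d T N x y ≤ δ :=
  Real.iSup_le (fun n => h n n.2) hδ

lemma spBowen_ge {X : Type*} (d : X → X → ℝ) (T : X → X) (N : ℕ) (x y : X) (n : ℕ) (hn : n < N) :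
    d (T^[n] x) (T^[n] y) ≤ bowen d T N x y :=
  le_ciSup (f := fun n : Fin N => d (T^[(n : ℕ)] x) (T^[(n : ℕ)] y))
    (Set.finite_range _).bddAbove ⟨n, hn⟩

lemma spSym_cov {r : ℕ} {m : ℕ → ℕ} {Ω : Set (ℕ → ℕ → ℕ)} (hΩ : SpDig r m Ω) (hs : SpSh Ω)
    (hne : Ω.Nonempty) (i : ℕ) (hi : i ≤ r) (ε : ℝ) (hε1 : ε ≤ 1) (p : ℕ)
    (hp : (2 : ℝ)⁻¹ ^ p < ε) (N : ℕ) :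
    (spWd Ω i N).card ≤ covNumBy (bowen (fun x y : ↥(truncL i '' Ω) =>
        symDist r (x : ℕ → ℕ → ℕ) (y : ℕ → ℕ → ℕ))
      (fun x => if h : (fun k l => (x : ℕ → ℕ → ℕ) (k + 1) l) ∈ (truncL i '' Ω)
        then ⟨_, h⟩ else x) N) ε ∧
    covNumBy (bowen (fun x y : ↥(truncL i '' Ω) =>
        symDist r (x : ℕ → ℕ → ℕ) (y : ℕ → ℕ → ℕ))
      (fun x => if h : (fun k l => (x : ℕ → ℕ → ℕ) (k + 1) l) ∈ (truncL i '' Ω)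
        then ⟨_, h⟩ else x) N) ε ≤ (spWd Ω i (N + p)).card := by
  have hsS : SpSh (truncL i '' Ω) := by
    rintro _ ⟨x, hx, rfl⟩
    exact ⟨_, hs x hx, rfl⟩
  have hrt : ∀ n x, spRestr i n (truncL i x) = spRestr i n x := by
    intro n x
    rw [spRestr_eq]
    intro k _ l hl
    simp [truncL, hl]
  have hup := spCov_le (bowen (fun x y : ↥(truncL i '' Ω) =>
        symDist r (x : ℕ → ℕ → ℕ) (y : ℕ → ℕ → ℕ))
      (fun x => if h : (fun k l => (x : ℕ → ℕ → ℕ) (k + 1) l) ∈ (truncL i '' Ω)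
        then ⟨_, h⟩ else x) N) ε (spWd Ω i (N + p))
      (fun c => {x : ↥(truncL i '' Ω) | spRestr i (N + p) (x : ℕ → ℕ → ℕ) = c}) ?_ ?_
  rotate_left
  · intro c hc
    refine spDiam_lt _ _ _ (by positivity) hp _ ?_
    intro x hx y hy
    refine spBowen_le _ _ _ _ _ _ (by positivity) ?_
    intro n hn
    refine symDist_le _ _ _ _ ?_
    intro k hk l hl1 hl2
    rw [spSym_iter _ hsS, spSym_iter _ hsS]
    simp only
    by_cases hl : l ≤ i
    · exact (spRestr_eq _ _ _ _).1 (hx.trans hy.symm) (k + n) (by omega) l hl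
    · obtain ⟨_, x, hx', rfl⟩ := x
      obtain ⟨_, y, hy', rfl⟩ := y
      simp [truncL, hl]
  · rintro ⟨_, x, hx, rfl⟩
    exact ⟨_, (mem_spWd hΩ _ _ _).2 ⟨x, hx, rfl⟩, hrt _ _⟩
  refine ⟨?_, hup.2⟩
  have hex : ∀ c, ∃ s : ↥(truncL i '' Ω), c ∈ spWd Ω i N → spRestr i N (s : ℕ → ℕ → ℕ) = c := by
    intro c
    by_cases hc : c ∈ spWd Ω i N
    · obtain ⟨x, hx, rfl⟩ := (mem_spWd hΩ _ _ _).1 hc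
      exact ⟨⟨_, x, hx, rfl⟩, fun _ => hrt _ _⟩
    · obtain ⟨x, hx⟩ := hne
      exact ⟨⟨_, x, hx, rfl⟩, fun h => absurd h hc⟩
  choose f hf using hex
  have := spCov_ge _ ε ⟨_, hup.1⟩ (spWd Ω i N) f 1 ?_
  · simpa using this
  intro U hU
  rw [Finset.card_le_one]
  intro c hc c' hc'
  rw [Finset.mem_filter] at hc hc'
  rw [← hf c hc.1, ← hf c' hc'.1, spRestr_eq]
  have hb := spDiam_ge _ ε 1 (fun x y => spBowen_le _ _ _ _ _ _ zero_le_one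
    (fun n hn => by simpa using symDist_le r 0 _ _ (fun k hk => by omega))) U hU _ _ hc.2 hc'.2
  intro k hk l hl
  by_cases hl0 : l = 0
  · obtain ⟨x, hx, hx'⟩ := (f c).2
    obtain ⟨y, hy, hy'⟩ := (f c').2
    rw [← hx', ← hy']
    simp only [truncL]
    rw [(hΩ x hx k l).2 (Or.inl hl0), (hΩ y hy k l).2 (Or.inl hl0)]
  · have h1 := lt_of_lt_of_le (lt_of_le_of_lt (spBowen_ge _ _ _ _ _ k hk) hb) hε1
    have h2 := symDist_lt_one _ _ _ h1 l (by omega) (by omega)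
    rw [spSym_iter _ hsS, spSym_iter _ hsS] at h2
    simpa using h2

lemma spEnt {r : ℕ} {m : ℕ → ℕ} {Ω : Set (ℕ → ℕ → ℕ)} (hΩ : SpDig r m Ω) (hs : SpSh Ω)
    (hne : Ω.Nonempty) (i : ℕ) (hi : i ≤ r) (h : ℝ)
    (hlim : Tendsto (fun N : ℕ => Real.log (spWd Ω i N).card / N) atTop (nhds h)) :
    subshiftEnt r (truncL i '' Ω) = h := by
  unfold subshiftEnt topEnt
  refine Tendsto.limsup_eq ?_
  refine (tendsto_const_nhds (x := h)).congr' ?_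
  have hIoo : Set.Ioo (0 : ℝ) 1 ∈ nhdsWithin (0 : ℝ) (Set.Ioi 0) := Ioo_mem_nhdsGT one_pos
  filter_upwards [hIoo] with ε hε
  obtain ⟨p, hp⟩ := exists_pow_lt_of_lt_one hε.1 (show (2 : ℝ)⁻¹ < 1 by norm_num)
  symm
  refine Tendsto.limsup_eq ?_
  refine tendsto_of_tendsto_of_tendsto_of_le_of_le hlim
    (spTend_shift (fun N => Real.log (spWd Ω i N).card) h p hlim) ?_ ?_
  · intro N
    have := (spSym_cov hΩ hs hne i hi ε hε.2.le p hp N).1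
    have h0 := spWd_pos hΩ hne i N
    simp only
    gcongr
  · intro N
    have h1 := (spSym_cov hΩ hs hne i hi ε hε.2.le p hp N)
    have h0 := spWd_pos hΩ hne i N
    have h2 := h0.trans_le h1.1
    simp only
    gcongr
    exact h1.2

/-! ### the sponge metric -/

lemma spSup_le (r : ℕ) (a : ℕ → ℝ) (δ : ℝ) (hδ : 0 ≤ δ) (h : ∀ l, 1 ≤ l → l ≤ r → a l ≤ δ) :
    (⨆ l ∈ Finset.Icc 1 r, a l) ≤ δ := by
  refine Real.iSup_le (fun l => Real.iSup_le (fun hl => ?_) hδ) hδ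
  rw [Finset.mem_Icc] at hl
  exact h l hl.1 hl.2

lemma spSup_nonneg (r : ℕ) (a : ℕ → ℝ) (h : ∀ l, 0 ≤ a l) :
    0 ≤ (⨆ l ∈ Finset.Icc 1 r, a l) :=
  Real.iSup_nonneg (fun l => Real.iSup_nonneg (fun _ => h l))

lemma le_spSup (r : ℕ) (a : ℕ → ℝ) (δ : ℝ) (hδ : 0 ≤ δ) (h : ∀ l, 1 ≤ l → l ≤ r → a l ≤ δ)
    (l : ℕ) (h1 : 1 ≤ l) (h2 : l ≤ r) : a l ≤ (⨆ l ∈ Finset.Icc 1 r, a l) := by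
  have hb : BddAbove (Set.range (fun l => ⨆ (_ : l ∈ Finset.Icc 1 r), a l)) := by
    refine ⟨δ, ?_⟩
    rintro _ ⟨l, rfl⟩
    refine Real.iSup_le (fun hl => ?_) hδ
    rw [Finset.mem_Icc] at hl
    exact h l hl.1 hl.2
  refine le_trans ?_ (le_ciSup hb l)
  rw [ciSup_pos (Finset.mem_Icc.2 ⟨h1, h2⟩)]

lemma spHalf : HasSum (fun j : ℕ => ((2 : ℝ)⁻¹) ^ (j + 1)) 1 := by
  have h := hasSum_geometric_two' (1 : ℝ)
  have e : (fun j : ℕ => ((2 : ℝ)⁻¹) ^ (j + 1)) = fun n : ℕ => (1 : ℝ) / 2 / 2 ^ n := by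
    ext j
    rw [inv_pow, pow_succ]
    field_simp
  rw [e]
  exact h

lemma spDist_summable (r : ℕ) (z w : ℕ → ℕ → ℝ)
    (h : ∀ j l, 1 ≤ l → l ≤ r → |z j l - w j l| ≤ 1) :
    Summable (fun j : ℕ => ((2 : ℝ)⁻¹) ^ (j + 1) * (⨆ l ∈ Finset.Icc 1 r, |z j l - w j l|)) := by
  refine Summable.of_nonneg_of_le (fun j => ?_) (fun j => ?_) spHalf.summable
  · exact mul_nonneg (by positivity) (spSup_nonneg _ _ (fun _ => abs_nonneg _))
  · exact mul_le_of_le_one_right (by positivity) (spSup_le _ _ _ zero_le_one (h j))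

lemma spDist_ge (r : ℕ) (z w : ℕ → ℕ → ℝ)
    (h : ∀ j l, 1 ≤ l → l ≤ r → |z j l - w j l| ≤ 1) (l : ℕ) (h1 : 1 ≤ l) (h2 : l ≤ r) :
    |z 0 l - w 0 l| ≤ 2 * spongeDist r z w := by
  have hs := spDist_summable r z w h
  have h3 := hs.le_tsum 0 (fun j _ =>
    mul_nonneg (by positivity) (spSup_nonneg _ _ (fun _ => abs_nonneg _)))
  have h4 := le_spSup r (fun l => |z 0 l - w 0 l|) 1 zero_le_one (h 0) l h1 h2
  unfold spongeDist
  rw [zero_add, pow_one] at h3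
  linarith

lemma spDist_le (r : ℕ) (z w : ℕ → ℕ → ℝ)
    (h : ∀ j l, 1 ≤ l → l ≤ r → |z j l - w j l| ≤ 1) (p : ℕ) (δ : ℝ) (hδ : 0 ≤ δ)
    (hp : ∀ j < p, ∀ l, 1 ≤ l → l ≤ r → |z j l - w j l| ≤ δ) :
    spongeDist r z w ≤ δ + (2 : ℝ)⁻¹ ^ p := by
  have hs := spDist_summable r z w h
  unfold spongeDist
  rw [← hs.sum_add_tsum_nat_add p]
  refine add_le_add ?_ ?_
  · have h1 : ∑ j ∈ Finset.range p, ((2 : ℝ)⁻¹) ^ (j + 1) * (⨆ l ∈ Finset.Icc 1 r, |z j l - w j l|)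
        ≤ ∑ j ∈ Finset.range p, ((2 : ℝ)⁻¹) ^ (j + 1) * δ := by
      refine Finset.sum_le_sum (fun j hj => ?_)
      refine mul_le_mul_of_nonneg_left ?_ (by positivity)
      exact spSup_le _ _ _ hδ (hp j (Finset.mem_range.1 hj))
    refine h1.trans ?_
    rw [← Finset.sum_mul]
    refine mul_le_of_le_one_left hδ ?_
    rw [← spHalf.tsum_eq]
    exact spHalf.summable.sum_le_tsum _ (fun _ _ => by positivity)
  · have h3 := spHalf.mul_left ((2 : ℝ)⁻¹ ^ p)
    rw [mul_one] at h3
    rw [← h3.tsum_eq]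
    refine Summable.tsum_le_tsum (fun j => ?_) ((summable_nat_add_iff p).2 hs) h3.summable
    have h4 := spSup_le r (fun l => |z (j + p) l - w (j + p) l|) 1 zero_le_one (h (j + p))
    calc _ ≤ (2 : ℝ)⁻¹ ^ (j + p + 1) * 1 := mul_le_mul_of_nonneg_left h4 (by positivity)
      _ = _ := by rw [mul_one, ← pow_add]; congr 1; omega

lemma spSponge_shift {m : ℕ → ℕ} {Ω : Set (ℕ → ℕ → ℕ)} (hs : SpSh Ω) (z : ℕ → ℕ → ℝ)
    (hz : z ∈ spongeSet m Ω) : spongeShift z ∈ spongeSet m Ω := by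
  obtain ⟨ω, h1, h2⟩ := hz
  exact ⟨fun k j l => ω k (j + 1) l, fun k => hs _ (h1 k), fun j l => h2 (j + 1) l⟩

lemma spSponge_iter {m : ℕ → ℕ} {Ω : Set (ℕ → ℕ → ℕ)} (hs : SpSh Ω) (n : ℕ)
    (z : ↥(spongeSet m Ω)) :
    (((fun z : ↥(spongeSet m Ω) => if h : spongeShift (z : ℕ → ℕ → ℝ) ∈ spongeSet m Ω
      then (⟨_, h⟩ : ↥(spongeSet m Ω)) else z)^[n] z : ↥(spongeSet m Ω)) : ℕ → ℕ → ℝ) =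
      fun j l => (z : ℕ → ℕ → ℝ) (j + n) l := by
  induction n generalizing z with
  | zero => rfl
  | succ n ih =>
    rw [Function.iterate_succ_apply, ih, dif_pos (spSponge_shift hs _ z.2)]
    ext k l
    simp only [spongeShift]
    congr 1

lemma spSponge_le_one {r : ℕ} {m : ℕ → ℕ} {Ω : Set (ℕ → ℕ → ℕ)} (hΩ : SpDig r m Ω)
    (hm2 : ∀ l, 1 ≤ l → l ≤ r → 2 ≤ m l) (z w : ℕ → ℕ → ℝ) (hz : z ∈ spongeSet m Ω)
    (hw : w ∈ spongeSet m Ω) (j l : ℕ) (h1 : 1 ≤ l) (h2 : l ≤ r) : |z j l - w j l| ≤ 1 := by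
  obtain ⟨ω, hω, hz⟩ := hz
  obtain ⟨η, hη, hw⟩ := hw
  have a := spVal_bounds (m l) (hm2 l h1 h2) (fun k => ω k j l)
    (fun k => (hΩ _ (hω k) j l).1 h1 h2)
  have b := spVal_bounds (m l) (hm2 l h1 h2) (fun k => η k j l)
    (fun k => (hΩ _ (hη k) j l).1 h1 h2)
  have e1 : z j l = spVal (m l) (fun k => ω k j l) := hz j l
  have e2 : w j l = spVal (m l) (fun k => η k j l) := hw j l
  rw [e1, e2, abs_le]
  constructor <;> linarith

/-! ### approximate cubes -/

noncomputable def spLev (L : ℕ → ℕ) (r k : ℕ) : ℕ := Nat.findGreatest (fun l => 1 ≤ l ∧ k < L l) r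

lemma le_spLev (L : ℕ → ℕ) (r k : ℕ) (hL : ∀ s t, 1 ≤ s → s ≤ t → t ≤ r → L t ≤ L s)
    (t : ℕ) (h1 : 1 ≤ t) (h2 : t ≤ r) : t ≤ spLev L r k ↔ k < L t := by
  constructor
  · intro h
    have h0 : spLev L r k ≠ 0 := by omega
    have h3 := Nat.findGreatest_of_ne_zero (P := fun l => 1 ≤ l ∧ k < L l) rfl h0
    exact lt_of_lt_of_le h3.2 (hL _ _ h1 h (Nat.findGreatest_le r))
  · intro h
    exact Nat.le_findGreatest h2 ⟨h1, h⟩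

noncomputable def spCubes (Ω : Set (ℕ → ℕ → ℕ)) (r : ℕ) (L : ℕ → ℕ) (N : ℕ) :
    Finset (Fin (L 1) → ℕ → ℕ → ℕ) :=
  Fintype.piFinset (fun k : Fin (L 1) => spWd Ω (spLev L r k) N)

lemma spCubes_log {r : ℕ} {m : ℕ → ℕ} {Ω : Set (ℕ → ℕ → ℕ)} (hΩ : SpDig r m Ω)
    (hne : Ω.Nonempty) (L : ℕ → ℕ) (hL : ∀ s t, 1 ≤ s → s ≤ t → t ≤ r → L t ≤ L s) (N : ℕ) :
    0 < (spCubes Ω r L N).card ∧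
    Real.log (spCubes Ω r L N).card = ∑ t ∈ Finset.range r, (L (t + 1) : ℝ) *
      (Real.log (spWd Ω (t + 1) N).card - Real.log (spWd Ω t N).card) := by
  have hpos := spWd_pos hΩ hne
  rw [spCubes, Fintype.card_piFinset]
  refine ⟨Finset.prod_pos (fun k _ => hpos _ _), ?_⟩
  push_cast
  rw [Real.log_prod (fun k _ => by exact_mod_cast (hpos _ _).ne')]
  have hk : ∀ k : ℕ, Real.log (spWd Ω (spLev L r k) N).card = ∑ t ∈ Finset.range r,
      if k < L (t + 1) then
        (Real.log (spWd Ω (t + 1) N).card - Real.log (spWd Ω t N).card) else 0 := by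
    intro k
    rw [← Finset.sum_filter]
    have : (Finset.range r).filter (fun t => k < L (t + 1)) = Finset.range (spLev L r k) := by
      ext t
      simp only [Finset.mem_filter, Finset.mem_range]
      constructor
      · rintro ⟨h1, h2⟩
        exact (le_spLev L r k hL (t + 1) (by omega) (by omega)).2 h2
      · intro h
        have h3 : spLev L r k ≤ r := Nat.findGreatest_le r
        exact ⟨by omega, (le_spLev L r k hL (t + 1) (by omega) (by omega)).1 h⟩
    rw [this, Finset.sum_range_sub (fun t => Real.log (spWd Ω t N).card), spWd_zero hΩ hne]
    simp
  simp only [hk]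
  rw [Finset.sum_comm]
  refine Finset.sum_congr rfl (fun t ht => ?_)
  rw [Finset.mem_range] at ht
  rw [Fin.sum_univ_eq_sum_range (fun k => if k < L (t + 1) then
        (Real.log (spWd Ω (t + 1) N).card - Real.log (spWd Ω t N).card) else 0) (L 1)]
  rw [← Finset.sum_filter]
  have : (Finset.range (L 1)).filter (fun k => k < L (t + 1)) = Finset.range (L (t + 1)) := by
    ext k
    have := hL 1 (t + 1) le_rfl (by omega) (by omega)
    simp only [Finset.mem_filter, Finset.mem_range]
    omega
  rw [this, Finset.sum_const, Finset.card_range, nsmul_eq_mul]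

lemma spCube_upper {r : ℕ} {m : ℕ → ℕ} {Ω : Set (ℕ → ℕ → ℕ)} (hΩ : SpDig r m Ω) (hs : SpSh Ω)
    (hm2 : ∀ l, 1 ≤ l → l ≤ r → 2 ≤ m l)
    (L : ℕ → ℕ) (hL : ∀ s t, 1 ≤ s → s ≤ t → t ≤ r → L t ≤ L s) (ε : ℝ) (hε : 0 < ε) (p : ℕ)
    (hp : (2 : ℝ)⁻¹ ^ p ≤ ε / 4) (hLε : ∀ l, 1 ≤ l → l ≤ r → 1 / (m l : ℝ) ^ (L l) ≤ ε / 4)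
    (N : ℕ) :
    (∃ n, ∃ F : Fin n → Set ↥(spongeSet m Ω), (∀ i, diamBy (bowen
          (fun z w : ↥(spongeSet m Ω) => spongeDist r z w)
            (fun z => if h : spongeShift (z : ℕ → ℕ → ℝ) ∈ spongeSet m Ω then ⟨_, h⟩ else z)
            N) (F i) < ε) ∧ (⋃ i, F i) = Set.univ) ∧
    covNumBy
          (bowen (fun z w : ↥(spongeSet m Ω) => spongeDist r z w)
            (fun z => if h : spongeShift (z : ℕ → ℕ → ℝ) ∈ spongeSet m Ω then ⟨_, h⟩ else z)
            N) ε ≤ (spCubes Ω r L (N + p)).card := by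
  have key := spCov_le (bowen (fun z w : ↥(spongeSet m Ω) => spongeDist r z w)
            (fun z => if h : spongeShift (z : ℕ → ℕ → ℝ) ∈ spongeSet m Ω then ⟨_, h⟩ else z)
            N) ε (spCubes Ω r L (N + p))
    (fun c => {z | ∃ ω : ℕ → (ℕ → ℕ → ℕ), (∀ k, ω k ∈ Ω) ∧
      (∀ j l, (z : ℕ → ℕ → ℝ) j l = spVal (m l) (fun k => ω k j l)) ∧
      ∀ k : Fin (L 1), spRestr (spLev L r k) (N + p) (ω k) = c k}) ?_ ?_
  · exact ⟨⟨_, key.1⟩, key.2⟩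
  · intro c hc
    refine spDiam_lt _ _ (ε / 4 + ε / 4) (by positivity) (by linarith) _ ?_
    rintro z ⟨ω, hω, hzω, hcω⟩ w ⟨η, hη, hwη, hcη⟩
    refine spBowen_le _ _ _ _ _ _ (by positivity) ?_
    intro n hn
    have h1 := spDist_le r _ _ (spSponge_le_one hΩ hm2 _ _
      ((fun z : ↥(spongeSet m Ω) => if h : spongeShift (z : ℕ → ℕ → ℝ) ∈ spongeSet m Ω
        then (⟨_, h⟩ : ↥(spongeSet m Ω)) else z)^[n] z).2
      ((fun z : ↥(spongeSet m Ω) => if h : spongeShift (z : ℕ → ℕ → ℝ) ∈ spongeSet m Ω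
        then (⟨_, h⟩ : ↥(spongeSet m Ω)) else z)^[n] w).2) p (ε / 4) (by positivity) ?_
    · exact h1.trans (by linarith)
    · intro j hj l hl1 hl2
      rw [spSponge_iter hs, spSponge_iter hs]
      simp only
      rw [hzω, hwη]
      have a := spVal_pre (m l) (hm2 l hl1 hl2) (fun k => ω k (j + n) l)
        (fun k => (hΩ _ (hω k) (j + n) l).1 hl1 hl2) (L l)
      have b := spVal_pre (m l) (hm2 l hl1 hl2) (fun k => η k (j + n) l)
        (fun k => (hΩ _ (hη k) (j + n) l).1 hl1 hl2) (L l)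
      have e : spPre (m l) (fun k => ω k (j + n) l) (L l)
          = spPre (m l) (fun k => η k (j + n) l) (L l) := by
        refine spPre_congr _ _ _ _ (fun k hk => ?_)
        have hk1 : k < L 1 := lt_of_lt_of_le hk (hL 1 l le_rfl hl1 hl2)
        have h3 := (hcω ⟨k, hk1⟩).trans (hcη ⟨k, hk1⟩).symm
        rw [spRestr_eq] at h3
        exact h3 (j + n) (by omega) l ((le_spLev L r k hL l hl1 hl2).2 hk)
      rw [e] at a
      have h4 := hLε l hl1 hl2
      rw [add_div] at a b
      rw [abs_le]
      constructor <;> linarith [a.1, a.2, b.1, b.2]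
  · rintro ⟨z, ω, hω, hz⟩
    refine ⟨fun k => spRestr (spLev L r k) (N + p) (ω k), ?_, ω, hω, hz, fun k => rfl⟩
    rw [spCubes, Fintype.mem_piFinset]
    intro k
    exact (mem_spWd hΩ _ _ _).2 ⟨_, hω k, rfl⟩

lemma spCube_lower {r : ℕ} {m : ℕ → ℕ} {Ω : Set (ℕ → ℕ → ℕ)} (hΩ : SpDig r m Ω) (hs : SpSh Ω)
    (hne : Ω.Nonempty) (hm2 : ∀ l, 1 ≤ l → l ≤ r → 2 ≤ m l)
    (L : ℕ → ℕ) (hL : ∀ s t, 1 ≤ s → s ≤ t → t ≤ r → L t ≤ L s) (ε : ℝ)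
    (hLε : ∀ l, 1 ≤ l → l ≤ r → ε * (m l : ℝ) ^ (L l) ≤ 1)
    (N : ℕ)
    (hex : ∃ n, ∃ F : Fin n → Set ↥(spongeSet m Ω), (∀ i, diamBy (bowen
          (fun z w : ↥(spongeSet m Ω) => spongeDist r z w)
            (fun z => if h : spongeShift (z : ℕ → ℕ → ℝ) ∈ spongeSet m Ω then ⟨_, h⟩ else z)
            N) (F i) < ε) ∧ (⋃ i, F i) = Set.univ) :
    (spCubes Ω r L N).card ≤ 5 ^ (N * r) * covNumBy
          (bowen (fun z w : ↥(spongeSet m Ω) => spongeDist r z w)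
            (fun z => if h : spongeShift (z : ℕ → ℕ → ℝ) ∈ spongeSet m Ω then ⟨_, h⟩ else z)
            N) ε := by
  have hω : ∀ c, ∃ ω : ℕ → (ℕ → ℕ → ℕ), (∀ k, ω k ∈ Ω) ∧ (c ∈ spCubes Ω r L N →
      ∀ k : Fin (L 1), spRestr (spLev L r k) N (ω k) = c k) := by
    intro c
    obtain ⟨x0, hx0⟩ := hne
    by_cases hc : c ∈ spCubes Ω r L N
    · rw [spCubes, Fintype.mem_piFinset] at hc
      have : ∀ k : Fin (L 1), ∃ x ∈ Ω, spRestr (spLev L r k) N x = c k :=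
        fun k => (mem_spWd hΩ _ _ _).1 (hc k)
      choose x hx hxc using this
      refine ⟨fun k => if h : k < L 1 then x ⟨k, h⟩ else x0, fun k => ?_, fun _ k => ?_⟩
      · dsimp only
        split_ifs
        · exact hx _
        · exact hx0
      · simp only [k.2, dif_pos]
        exact hxc k
    · exact ⟨fun _ => x0, fun _ => hx0, fun h => absurd h hc⟩
  choose ω hω hωc using hω
  let f : (Fin (L 1) → ℕ → ℕ → ℕ) → ↥(spongeSet m Ω) := fun c =>
    ⟨fun j l => spVal (m l) (fun k => ω c k j l), ω c, hω c, fun j l => rfl⟩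
  refine spCov_ge _ ε hex (spCubes Ω r L N) f _ ?_
  intro U hU
  rcases Finset.eq_empty_or_nonempty ((spCubes Ω r L N).filter (fun c => f c ∈ U)) with he | he
  · rw [he]; simp
  obtain ⟨c0, hc0⟩ := he
  rw [Finset.mem_filter] at hc0
  let u : (Fin (L 1) → ℕ → ℕ → ℕ) → ℕ → ℕ → ℤ := fun c j l =>
    (spPre (m l) (fun k => ω c k j l) (L l) : ℤ)
  have hcard : (Fintype.piFinset (fun _ : Fin N × Fin r => Finset.Icc (-2 : ℤ) 2)).card
      = 5 ^ (N * r) := by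
    rw [Fintype.card_piFinset]
    simp
  rw [← hcard]
  refine Finset.card_le_card_of_injOn
    (fun c q => u c (q.1 : ℕ) ((q.2 : ℕ) + 1) - u c0 (q.1 : ℕ) ((q.2 : ℕ) + 1)) ?_ ?_
  · intro c hc
    rw [Finset.mem_coe, Finset.mem_filter] at hc
    rw [Finset.mem_coe, Fintype.mem_piFinset]
    rintro ⟨⟨j, hj⟩, ⟨l', hl'⟩⟩
    simp only
    obtain ⟨l, hl⟩ : ∃ l, l = l' + 1 := ⟨_, rfl⟩
    rw [← hl]
    have hl1 : 1 ≤ l := by omega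
    have hl2 : l ≤ r := by omega
    have hb := spDiam_ge _ ε 1 (fun x y => spBowen_le _ _ _ _ _ _ zero_le_one
      (fun n hn => by
        have := spDist_le r _ _ (spSponge_le_one hΩ hm2 _ _
          ((fun z : ↥(spongeSet m Ω) => if h : spongeShift (z : ℕ → ℕ → ℝ) ∈ spongeSet m Ω
            then (⟨_, h⟩ : ↥(spongeSet m Ω)) else z)^[n] x).2
          ((fun z : ↥(spongeSet m Ω) => if h : spongeShift (z : ℕ → ℕ → ℝ) ∈ spongeSet m Ω
            then (⟨_, h⟩ : ↥(spongeSet m Ω)) else z)^[n] y).2) 0 0 le_rfl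
          (fun j hj => by omega)
        simpa using this)) U hU _ _ hc.2 hc0.2
    have h1 := lt_of_le_of_lt (spBowen_ge _ _ _ _ _ j hj) hb
    have h2 := spDist_ge r _ _ (spSponge_le_one hΩ hm2 _ _
          ((fun z : ↥(spongeSet m Ω) => if h : spongeShift (z : ℕ → ℕ → ℝ) ∈ spongeSet m Ω
            then (⟨_, h⟩ : ↥(spongeSet m Ω)) else z)^[j] (f c)).2
          ((fun z : ↥(spongeSet m Ω) => if h : spongeShift (z : ℕ → ℕ → ℝ) ∈ spongeSet m Ω
            then (⟨_, h⟩ : ↥(spongeSet m Ω)) else z)^[j] (f c0)).2) l hl1 hl2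
    have h3 := lt_of_le_of_lt h2 (mul_lt_mul_of_pos_left h1 two_pos)
    rw [spSponge_iter hs, spSponge_iter hs] at h3
    simp only [zero_add, f] at h3
    have a := spVal_pre (m l) (hm2 l hl1 hl2) (fun k => ω c k j l)
      (fun k => (hΩ _ (hω c k) j l).1 hl1 hl2) (L l)
    have b := spVal_pre (m l) (hm2 l hl1 hl2) (fun k => ω c0 k j l)
      (fun k => (hΩ _ (hω c0 k) j l).1 hl1 hl2) (L l)
    have hm : (0 : ℝ) < (m l : ℝ) ^ (L l) := by
      have : 0 < m l := by have := hm2 l hl1 hl2; omega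
      positivity
    have h4 := hLε l hl1 hl2
    rw [div_le_iff₀ hm, le_div_iff₀ hm] at a b
    rw [abs_lt] at h3
    have h5 := mul_lt_mul_of_pos_right h3.1 hm
    have h6 := mul_lt_mul_of_pos_right h3.2 hm
    have h7 : ((u c j l - u c0 j l : ℤ) : ℝ) < 3 := by
      simp only [u]; push_cast; nlinarith [a.1, a.2, b.1, b.2]
    have h8 : (-3 : ℝ) < ((u c j l - u c0 j l : ℤ) : ℝ) := by
      simp only [u]; push_cast; nlinarith [a.1, a.2, b.1, b.2]
    have h7' : u c j l - u c0 j l < 3 := by exact_mod_cast h7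
    have h8' : -3 < u c j l - u c0 j l := by exact_mod_cast h8
    rw [Finset.mem_Icc]
    omega
  · intro c hc c' hc' h
    rw [Finset.mem_coe, Finset.mem_filter] at hc hc'
    funext k
    rw [← hωc c hc.1 k, ← hωc c' hc'.1 k, spRestr_eq]
    intro j hj l hl
    by_cases hl0 : l = 0
    · rw [(hΩ _ (hω c k) j l).2 (Or.inl hl0), (hΩ _ (hω c' k) j l).2 (Or.inl hl0)]
    · have hl1 : 1 ≤ l := by omega
      have hl2 : l ≤ r := hl.trans (Nat.findGreatest_le r)
      have h1 := congrFun h (⟨j, hj⟩, ⟨l - 1, by omega⟩)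
      simp only [Nat.sub_add_cancel hl1, u] at h1
      have h2 : spPre (m l) (fun k => ω c k j l) (L l) = spPre (m l) (fun k => ω c' k j l) (L l) := by
        omega
      exact spPre_inj (m l) _ _ (fun k => (hΩ _ (hω c k) j l).1 hl1 hl2)
        (fun k => (hΩ _ (hω c' k) j l).1 hl1 hl2) (L l) h2 k ((le_spLev L r k hL l hl1 hl2).1 hl)

/-! ### limits -/

lemma spAbel (a h : ℕ → ℝ) (h0 : h 0 = 0) (r : ℕ) (hr : 1 ≤ r) :
    h r * a r + ∑ i ∈ Finset.Icc 1 (r - 1), (a i - a (i + 1)) * h i =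
      ∑ t ∈ Finset.range r, a (t + 1) * (h (t + 1) - h t) := by
  induction r, hr using Nat.le_induction with
  | base => simp [h0, mul_comm]
  | succ n hn ih =>
    rw [Finset.sum_range_succ, ← ih]
    obtain ⟨k, rfl⟩ : ∃ k, n = k + 1 := ⟨n - 1, by omega⟩
    simp only [Nat.add_sub_cancel]
    rw [Finset.sum_Icc_succ_top (by omega)]
    ring

lemma spSqueeze (f a b : ℕ → ℝ) (A B : ℝ) (ha : Tendsto a atTop (nhds A))
    (hb : Tendsto b atTop (nhds B)) (h1 : ∀ᶠ n in atTop, a n ≤ f n)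
    (h2 : ∀ᶠ n in atTop, f n ≤ b n) :
    A ≤ liminf f atTop ∧ liminf f atTop ≤ limsup f atTop ∧ limsup f atTop ≤ B := by
  have bu : IsBoundedUnder (· ≤ ·) atTop f := hb.isBoundedUnder_le.mono_le h2
  have bl : IsBoundedUnder (· ≥ ·) atTop f := ha.isBoundedUnder_ge.mono_ge h1
  refine ⟨?_, liminf_le_limsup bu bl, ?_⟩
  · rw [← ha.liminf_eq]
    exact liminf_le_liminf h1 ha.isBoundedUnder_ge bu.isCoboundedUnder_ge
  · rw [← hb.limsup_eq]
    exact limsup_le_limsup h2 bl.isCoboundedUnder_le hb.isBoundedUnder_le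

lemma spLog_bounds (b : ℕ) (hb : 2 ≤ b) (ε : ℝ) (hε : ε ∈ Set.Ioo (0 : ℝ) 1) :
    ε * (b : ℝ) ^ (⌊1 / Real.log b * Real.log (1 / ε)⌋₊) ≤ 1 ∧
    1 / (b : ℝ) ^ (⌊1 / Real.log b * Real.log (1 / ε)⌋₊ + 3) ≤ ε / 4 := by
  have hb' : (2 : ℝ) ≤ b := by exact_mod_cast hb
  have hlb : 0 < Real.log b := Real.log_pos (by linarith)
  have h1e : 1 < 1 / ε := by rw [lt_div_iff₀ hε.1]; linarith [hε.2]
  have hle : 0 < Real.log (1 / ε) := Real.log_pos h1e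
  have hf1 := Nat.floor_le (show 0 ≤ 1 / Real.log b * Real.log (1 / ε) by positivity)
  have hf2 := Nat.lt_floor_add_one (1 / Real.log b * Real.log (1 / ε))
  set n := ⌊1 / Real.log b * Real.log (1 / ε)⌋₊
  rw [one_div_mul_eq_div, le_div_iff₀ hlb] at hf1
  rw [one_div_mul_eq_div, div_lt_iff₀ hlb] at hf2
  have hε0 := hε.1
  constructor
  · have : (b : ℝ) ^ n ≤ 1 / ε := by
      rw [← Real.log_le_log_iff (by positivity) (by positivity), Real.log_pow]
      exact hf1
    rw [le_div_iff₀ hε.1] at this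
    linarith
  · have : 1 / ε < (b : ℝ) ^ (n + 1) := by
      rw [← Real.log_lt_log_iff (by positivity) (by positivity), Real.log_pow]
      push_cast
      exact hf2
    rw [div_lt_iff₀ hε.1] at this
    rw [div_le_iff₀ (by positivity), show n + 3 = (n + 1) + 2 by ring, pow_add]
    have h4 : (4 : ℝ) ≤ (b : ℝ) ^ 2 := by nlinarith
    have h5 : 0 < (b : ℝ) ^ (n + 1) * ε := by positivity
    nlinarith

lemma spMain_eps {r : ℕ} {m : ℕ → ℕ} {Ω : Set (ℕ → ℕ → ℕ)} (hΩ : SpDig r m Ω) (hs : SpSh Ω)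
    (hne : Ω.Nonempty) (hm2 : ∀ l, 1 ≤ l → l ≤ r → 2 ≤ m l)
    (hmono : ∀ s t, 1 ≤ s → s ≤ t → t ≤ r → m s ≤ m t) (h : ℕ → ℝ)
    (hlim : ∀ i, Tendsto (fun N : ℕ => Real.log (spWd Ω i N).card / N) atTop (nhds (h i)))
    (ε : ℝ) (hε : ε ∈ Set.Ioo (0 : ℝ) 1) (f : ℕ → ℝ)
    (hf : f = fun N : ℕ =>
        Real.log (covNumBy
          (bowen (fun z w : ↥(spongeSet m Ω) => spongeDist r z w)
            (fun z => if h : spongeShift (z : ℕ → ℕ → ℝ) ∈ spongeSet m Ω then ⟨_, h⟩ else z)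
            N) ε) / ((N : ℝ) * Real.log (1 / ε))) :
    (∑ t ∈ Finset.range r, (⌊1 / Real.log (m (t + 1)) * Real.log (1 / ε)⌋₊ : ℝ) *
      (h (t + 1) - h t) - r * Real.log 5) / Real.log (1 / ε) ≤ liminf f atTop ∧
    liminf f atTop ≤ limsup f atTop ∧
    limsup f atTop ≤ (∑ t ∈ Finset.range r,
      ((⌊1 / Real.log (m (t + 1)) * Real.log (1 / ε)⌋₊ : ℝ) + 3) *
      (h (t + 1) - h t)) / Real.log (1 / ε) := by
  have h1e : 1 < 1 / ε := by rw [lt_div_iff₀ hε.1]; linarith [hε.2]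
  have hle : 0 < Real.log (1 / ε) := Real.log_pos h1e
  obtain ⟨L, hLdef⟩ : ∃ L : ℕ → ℕ, ∀ t, L t = ⌊1 / Real.log (m t) * Real.log (1 / ε)⌋₊ :=
    ⟨_, fun _ => rfl⟩
  have hL : ∀ s t, 1 ≤ s → s ≤ t → t ≤ r → L t ≤ L s := by
    intro s t h1 h2 h3
    rw [hLdef, hLdef]
    have hms := hm2 s h1 (h2.trans h3)
    have hmt := hmono s t h1 h2 h3
    have hms' : (2 : ℝ) ≤ m s := by exact_mod_cast hms
    have hmt' : (m s : ℝ) ≤ m t := by exact_mod_cast hmt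
    have : 0 < Real.log (m s) := Real.log_pos (by linarith)
    have : Real.log (m s) ≤ Real.log (m t) := Real.log_le_log (by linarith) hmt'
    gcongr
  have hb := fun l h1 h2 => spLog_bounds (m l) (hm2 l h1 h2) ε hε
  simp only [← hLdef] at hb ⊢
  obtain ⟨p, hp⟩ := exists_pow_lt_of_lt_one (show 0 < ε / 4 by linarith [hε.1])
    (show (2 : ℝ)⁻¹ < 1 by norm_num)
  have hup := spCube_upper hΩ hs hm2 (fun t => L t + 3)
    (fun s t h1 h2 h3 => Nat.add_le_add_right (hL s t h1 h2 h3) 3) ε hε.1 p hp.le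
    (fun l h1 h2 => (hb l h1 h2).2)
  have hlo := fun N => spCube_lower hΩ hs hne hm2 L hL ε (fun l h1 h2 => (hb l h1 h2).1) N (hup N).1
  have hcl := fun N => spCubes_log hΩ hne L hL N
  have hcu := fun N => spCubes_log hΩ hne (fun t => L t + 3)
    (fun s t h1 h2 h3 => Nat.add_le_add_right (hL s t h1 h2 h3) 3) N
  refine spSqueeze f
    (fun N : ℕ => (∑ t ∈ Finset.range r, (L (t + 1) : ℝ) *
      (Real.log (spWd Ω (t + 1) N).card / N - Real.log (spWd Ω t N).card / N) - r * Real.log 5)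
        / Real.log (1 / ε))
    (fun N : ℕ => (∑ t ∈ Finset.range r, ((L (t + 1) : ℝ) + 3) *
      (Real.log (spWd Ω (t + 1) (N + p)).card / N - Real.log (spWd Ω t (N + p)).card / N))
        / Real.log (1 / ε)) _ _ ?_ ?_ ?_ ?_
  · refine Tendsto.div_const (Tendsto.sub_const (tendsto_finsetSum _ fun t _ => ?_) _) _
    exact ((hlim (t + 1)).sub (hlim t)).const_mul _
  · refine Tendsto.div_const (tendsto_finsetSum _ fun t _ => ?_) _
    exact ((spTend_shift (fun N => Real.log (spWd Ω (t + 1) N).card) _ p (hlim (t + 1))).sub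
      (spTend_shift (fun N => Real.log (spWd Ω t N).card) _ p (hlim t))).const_mul _
  · filter_upwards [eventually_gt_atTop 0] with N hN
    have hN' : (0 : ℝ) < N := by exact_mod_cast hN
    rw [hf]
    simp only
    rw [← div_div]
    refine div_le_div_of_nonneg_right ?_ hle.le
    rw [le_div_iff₀ hN', sub_mul, Finset.sum_mul]
    have e : ∑ t ∈ Finset.range r, (L (t + 1) : ℝ) *
        (Real.log (spWd Ω (t + 1) N).card / N - Real.log (spWd Ω t N).card / N) * N
        = Real.log (spCubes Ω r L N).card := by
      rw [(hcl N).2]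
      refine Finset.sum_congr rfl fun t _ => ?_
      field_simp
    rw [e]
    have hc0 := (hcl N).1
    have h1 := hlo N
    have h2 := Nat.pos_of_mul_pos_left (hc0.trans_le h1)
    have h3 : Real.log (spCubes Ω r L N).card ≤ Real.log ((5 ^ (N * r) * covNumBy
          (bowen (fun z w : ↥(spongeSet m Ω) => spongeDist r z w)
            (fun z => if h : spongeShift (z : ℕ → ℕ → ℝ) ∈ spongeSet m Ω then ⟨_, h⟩ else z)
            N) ε : ℕ) : ℝ) := Real.log_le_log (by exact_mod_cast hc0) (by exact_mod_cast h1)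
    rw [Nat.cast_mul, Real.log_mul (by positivity) (by exact_mod_cast h2.ne')] at h3
    push_cast at h3
    rw [Real.log_pow] at h3
    push_cast at h3
    linarith
  · filter_upwards [eventually_gt_atTop 0] with N hN
    have hN' : (0 : ℝ) < N := by exact_mod_cast hN
    rw [hf]
    simp only
    rw [← div_div]
    refine div_le_div_of_nonneg_right ?_ hle.le
    rw [div_le_iff₀ hN', Finset.sum_mul]
    have e : ∑ t ∈ Finset.range r, ((L (t + 1) : ℝ) + 3) *
        (Real.log (spWd Ω (t + 1) (N + p)).card / N - Real.log (spWd Ω t (N + p)).card / N) * N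
        = Real.log (spCubes Ω r (fun t => L t + 3) (N + p)).card := by
      rw [(hcu (N + p)).2]
      refine Finset.sum_congr rfl fun t _ => ?_
      push_cast
      field_simp
    rw [e]
    have h2 := Nat.pos_of_mul_pos_left ((hcl N).1.trans_le (hlo N))
    exact Real.log_le_log (by exact_mod_cast h2) (by exact_mod_cast (hup N).2)

end Helpers

/-- Metric mean dimension of a sponge system: both the upper and lower metric mean
dimensions of `(X_Ω, σ, d)` equal
`h_top(Ω,σ)/log m_r + Σ_{i=1}^{r−1} (1/log m_i − 1/log m_{i+1}) h_top(π_i(Ω),σ)`. -/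
theorem sponge_metric_mean_dimension (r : ℕ) (hr : 1 ≤ r) (m : ℕ → ℕ)
    (hm2 : ∀ l, 1 ≤ l → l ≤ r → 2 ≤ m l)
    (hmono : ∀ l, 1 ≤ l → l < r → m l ≤ m (l + 1))
    (Ω : Set (ℕ → ℕ → ℕ))
    (hΩdig : ∀ x ∈ Ω, ∀ k l, (1 ≤ l → l ≤ r → x k l < m l) ∧ (l = 0 ∨ r < l → x k l = 0))
    (hΩclosed : IsClosed Ω)
    (hΩshift : ∀ x ∈ Ω, (fun k l => x (k + 1) l) ∈ Ω)
    (hΩnontriv : ∃ x ∈ Ω, ∃ y ∈ Ω, x ≠ y) :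
    (limsup (fun ε : ℝ => limsup (fun N : ℕ =>
        Real.log (covNumBy
          (bowen (fun z w : ↥(spongeSet m Ω) => spongeDist r z w)
            (fun z => if h : spongeShift (z : ℕ → ℕ → ℝ) ∈ spongeSet m Ω then ⟨_, h⟩ else z)
            N) ε) / ((N : ℝ) * Real.log (1 / ε))) atTop) (nhdsWithin 0 (Set.Ioi 0)) =
      subshiftEnt r Ω / Real.log (m r) +
        ∑ i ∈ Finset.Icc 1 (r - 1),
          (1 / Real.log (m i) - 1 / Real.log (m (i + 1))) *
            subshiftEnt r (truncL i '' Ω)) ∧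
    (liminf (fun ε : ℝ => liminf (fun N : ℕ =>
        Real.log (covNumBy
          (bowen (fun z w : ↥(spongeSet m Ω) => spongeDist r z w)
            (fun z => if h : spongeShift (z : ℕ → ℕ → ℝ) ∈ spongeSet m Ω then ⟨_, h⟩ else z)
            N) ε) / ((N : ℝ) * Real.log (1 / ε))) atTop) (nhdsWithin 0 (Set.Ioi 0)) =
      subshiftEnt r Ω / Real.log (m r) +
        ∑ i ∈ Finset.Icc 1 (r - 1),
          (1 / Real.log (m i) - 1 / Real.log (m (i + 1))) *
            subshiftEnt r (truncL i '' Ω)) := by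
  have hΩ : SpDig r m Ω := hΩdig
  have hs : SpSh Ω := hΩshift
  have hne : Ω.Nonempty := by
    obtain ⟨x, hx, _⟩ := hΩnontriv
    exact ⟨x, hx⟩
  have hmono' : ∀ s t, 1 ≤ s → s ≤ t → t ≤ r → m s ≤ m t := by
    intro s t h1 h2
    induction t, h2 using Nat.le_induction with
    | base => intro _; exact le_rfl
    | succ n hn ih =>
      intro h3
      exact (ih (by omega)).trans (hmono n (by omega) (by omega))
  choose h hlim using spH_exists hΩ hs hne
  have h0 : h 0 = 0 := by
    refine tendsto_nhds_unique (hlim 0) ?_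
    simp [spWd_zero hΩ hne]
  have htr : truncL r '' Ω = Ω := by
    have : ∀ x ∈ Ω, truncL r x = x := by
      intro x hx
      ext k l
      simp only [truncL]
      split_ifs with hl
      · rfl
      · exact ((hΩ x hx k l).2 (by omega)).symm
    rw [Set.image_congr this]
    simp
  have hEr : subshiftEnt r Ω = h r := by
    have := spEnt hΩ hs hne r le_rfl (h r) (hlim r)
    rwa [htr] at this
  have hV : subshiftEnt r Ω / Real.log (m r) +
        ∑ i ∈ Finset.Icc 1 (r - 1),
          (1 / Real.log (m i) - 1 / Real.log (m (i + 1))) *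
            subshiftEnt r (truncL i '' Ω) =
      ∑ t ∈ Finset.range r, 1 / Real.log (m (t + 1)) * (h (t + 1) - h t) := by
    rw [← spAbel (fun i => 1 / Real.log (m i)) h h0 r hr, hEr]
    congr 1
    · ring
    · refine Finset.sum_congr rfl fun i hi => ?_
      rw [Finset.mem_Icc] at hi
      rw [spEnt hΩ hs hne i (by omega) (h i) (hlim i)]
  rw [hV]
  have hIoo : Set.Ioo (0 : ℝ) 1 ∈ nhdsWithin (0 : ℝ) (Set.Ioi 0) := Ioo_mem_nhdsGT one_pos
  have hlog : Tendsto (fun ε : ℝ => Real.log (1 / ε)) (nhdsWithin 0 (Set.Ioi 0)) atTop := by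
    simp only [one_div]
    exact Real.tendsto_log_atTop.comp tendsto_inv_nhdsGT_zero
  have hL : ∀ t ∈ Finset.range r, Tendsto (fun ε : ℝ =>
      (⌊1 / Real.log (m (t + 1)) * Real.log (1 / ε)⌋₊ : ℝ) / Real.log (1 / ε))
      (nhdsWithin 0 (Set.Ioi 0)) (nhds (1 / Real.log (m (t + 1)))) := by
    intro t _
    have := (tendsto_nat_floor_mul_div_atTop (R := ℝ) (a := 1 / Real.log (m (t + 1)))
      (one_div_nonneg.2 (Real.log_natCast_nonneg _))).comp hlog
    exact this
  have hc : ∀ c : ℝ, Tendsto (fun ε : ℝ => c / Real.log (1 / ε))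
      (nhdsWithin 0 (Set.Ioi 0)) (nhds 0) := fun c => hlog.const_div_atTop c
  have hA : Tendsto (fun ε : ℝ => (∑ t ∈ Finset.range r,
      (⌊1 / Real.log (m (t + 1)) * Real.log (1 / ε)⌋₊ : ℝ) *
      (h (t + 1) - h t) - r * Real.log 5) / Real.log (1 / ε)) (nhdsWithin 0 (Set.Ioi 0))
      (nhds (∑ t ∈ Finset.range r, 1 / Real.log (m (t + 1)) * (h (t + 1) - h t))) := by
    have := (tendsto_finsetSum (Finset.range r) fun t ht =>
      (hL t ht).mul_const (h (t + 1) - h t)).sub (hc (r * Real.log 5))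
    rw [sub_zero] at this
    refine this.congr fun ε => ?_
    rw [sub_div, Finset.sum_div]
    congr 1
    refine Finset.sum_congr rfl fun t _ => ?_
    ring
  have hB : Tendsto (fun ε : ℝ => (∑ t ∈ Finset.range r,
      ((⌊1 / Real.log (m (t + 1)) * Real.log (1 / ε)⌋₊ : ℝ) + 3) *
      (h (t + 1) - h t)) / Real.log (1 / ε)) (nhdsWithin 0 (Set.Ioi 0))
      (nhds (∑ t ∈ Finset.range r, 1 / Real.log (m (t + 1)) * (h (t + 1) - h t))) := by
    have := (tendsto_finsetSum (Finset.range r) fun t ht =>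
      ((hL t ht).add (hc 3)).mul_const (h (t + 1) - h t))
    simp only [add_zero] at this
    refine this.congr fun ε => ?_
    rw [Finset.sum_div]
    refine Finset.sum_congr rfl fun t _ => ?_
    ring
  constructor
  · refine Tendsto.limsup_eq (tendsto_of_tendsto_of_tendsto_of_le_of_le' hA hB ?_ ?_)
    · filter_upwards [hIoo] with ε hε
      have := spMain_eps hΩ hs hne hm2 hmono' h hlim ε hε _ rfl
      exact this.1.trans this.2.1
    · filter_upwards [hIoo] with ε hε
      have := spMain_eps hΩ hs hne hm2 hmono' h hlim ε hε _ rfl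
      exact this.2.2
  · refine Tendsto.liminf_eq (tendsto_of_tendsto_of_tendsto_of_le_of_le' hA hB ?_ ?_)
    · filter_upwards [hIoo] with ε hε
      have := spMain_eps hΩ hs hne hm2 hmono' h hlim ε hε _ rfl
      exact this.1
    · filter_upwards [hIoo] with ε hε
      have := spMain_eps hΩ hs hne hm2 hmono' h hlim ε hε _ rfl
      exact this.2.1.trans this.2.2
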